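/- Let x_0 ≤ x_1 ≤ ⋯ ≤ x_k be a nondecreasing sequence of splitter strings, and for 1 ≤ i ≤ k let the bucket b_i consist of all strings s with x_{i−1} < s ≤ x_i in the lexicographic order. Then for every 1 ≤ i ≤ k and all strings s, t ∈ b_i, lcp(s,t) ≥ lcp(x_{i−1}, x_i). -/

import Mathlib

/-- The length of the longest common prefix of two lists. -/
def lcp {α : Type*} [DecidableEq α] : List α → List α → ℕ
  | a :: s, b :: t => if a = b then lcp s t + 1 else 0
  | _, _ => 0

theorem lcp_aux {α : Type*} [LinearOrder α] (a : List α) : ∀ b s t : List α,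
    a < s → ¬ b < s → a < t → ¬ b < t → lcp a b ≤ lcp s t := by
  induction a with
  | nil => intro b s t _ _ _ _; simp [lcp]
  | cons c a ih =>
    intro b s t h1 h2 h3 h4
    cases b with
    | nil => simp [lcp]
    | cons d b =>
      by_cases hcd : c = d
      · subst hcd
        cases s with
        | nil => simp at h1
        | cons e s =>
          cases t with
          | nil => simp at h3
          | cons f t =>
            rw [List.cons_lt_cons_iff] at h1 h2 h3 h4
            push Not at h2 h4
            have he : c = e := by
              rcases h1 with h | h
              · exact absurd h (not_lt.mpr h2.1)
              · exact h.1
            have hf : c = f := by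
              rcases h3 with h | h
              · exact absurd h (not_lt.mpr h4.1)
              · exact h.1
            subst he
            subst hf
            simp only [lcp, if_true]
            have := ih b s t (by simpa using h1) (not_lt.mpr (h2.2 rfl)) (by simpa using h3) (not_lt.mpr (h4.2 rfl))
            omega
      · simp [lcp, hcd]

/-- Let `x 0 ≤ x 1 ≤ ⋯ ≤ x k` be a nondecreasing sequence of splitter strings, and
for `1 ≤ i ≤ k` let bucket `b i` consist of all strings `s` with `x (i-1) < s ≤ x i`.
Then any two strings `s, t` in bucket `b i` satisfy `lcp s t ≥ lcp (x (i-1)) (x i)`. -/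
theorem bucket_lcp_ge_splitter_lcp {α : Type*} [LinearOrder α]
    (k : ℕ) (x : ℕ → List α)
    (hmono : ∀ i < k, x i ≤ x (i + 1))
    (i : ℕ) (h1 : 1 ≤ i) (hik : i ≤ k)
    (s t : List α)
    (hs1 : x (i - 1) < s) (hs2 : s ≤ x i)
    (ht1 : x (i - 1) < t) (ht2 : t ≤ x i) :
    lcp (x (i - 1)) (x i) ≤ lcp s t := by
  exact lcp_aux _ _ _ _ hs1 (not_lt.mpr hs2) ht1 (not_lt.mpr ht2)
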